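/- Let R be an associative unital ring, M a left R-module that is projective in σ[M], and P a fully invariant submodule of M. Then P is prime in M if and only if for all submodules K, L ≤ M with P ≤ K, P ≤ L and K·_M L ≤ P, either K = P or L = P. -/

import Mathlib

universe u v

section Defs

variable (R : Type u) [Ring R] (M : Type v) [AddCommGroup M] [Module R M]

/-- The product `K ·_M L` of submodules: the sum of all images `f K` over `f : M → L`. -/
def prodM (K L : Submodule R M) : Submodule R M :=
  ⨆ (f : M →ₗ[R] M) (_ : LinearMap.range f ≤ L), K.map f

/-- A submodule is fully invariant if it is stable under every endomorphism. -/
def IsFullyInvariant (N : Submodule R M) : Prop :=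
  ∀ f : M →ₗ[R] M, N.map f ≤ N

/-- A fully invariant submodule `N` is prime in `M` if `K ·_M L ≤ N` implies `K ≤ N` or
`L ≤ N` for all fully invariant submodules `K, L`. -/
def IsPrimeSubmodule (N : Submodule R M) : Prop :=
  IsFullyInvariant R M N ∧
    ∀ K L : Submodule R M, IsFullyInvariant R M K → IsFullyInvariant R M L →
      prodM R M K L ≤ N → K ≤ N ∨ L ≤ N

/-- A fully invariant submodule `N` is semiprime in `M` if `K ·_M K ≤ N` implies `K ≤ N`
for every fully invariant submodule `K`. -/
def IsSemiprimeSubmodule (N : Submodule R M) : Prop :=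
  IsFullyInvariant R M N ∧
    ∀ K : Submodule R M, IsFullyInvariant R M K → prodM R M K K ≤ N → K ≤ N

/-- `M` is a semiprime module if `⊥` is semiprime in `M`. -/
def IsSemiprimeModule : Prop := IsSemiprimeSubmodule R M ⊥

/-- `M` is a prime module if `⊥` is prime in `M`. -/
def IsPrimeModule : Prop := IsPrimeSubmodule R M ⊥

/-- A minimal prime submodule: prime and minimal among prime submodules. -/
def IsMinimalPrimeSubmodule (P : Submodule R M) : Prop :=
  IsPrimeSubmodule R M P ∧ ∀ Q : Submodule R M, IsPrimeSubmodule R M Q → Q ≤ P → Q = P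

/-- `X` is `M`-generated: a homomorphic image of a direct sum of copies of `M`. -/
def IsMGenerated (X : Type v) [AddCommGroup X] [Module R X] : Prop :=
  ∃ (ι : Type v) (f : (ι →₀ M) →ₗ[R] X), Function.Surjective f

/-- `X` belongs to `σ[M]`: isomorphic to a submodule of an `M`-generated module. -/
def InSigmaM (X : Type v) [AddCommGroup X] [Module R X] : Prop :=
  ∃ (Y : Type v) (_ : AddCommGroup Y) (_ : Module R Y),
    IsMGenerated R M Y ∧ ∃ g : X →ₗ[R] Y, Function.Injective g

/-- `M` is projective in `σ[M]`. -/
def ProjectiveInSigmaM : Prop :=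
  ∀ (A B : Type v) [AddCommGroup A] [Module R A] [AddCommGroup B] [Module R B],
    InSigmaM R M A → InSigmaM R M B →
      ∀ g : A →ₗ[R] B, Function.Surjective g →
        ∀ h : M →ₗ[R] B, ∃ f : M →ₗ[R] A, g ∘ₗ f = h

/-- `N` is essential in `M`. -/
def IsEssentialSub (N : Submodule R M) : Prop :=
  ∀ L : Submodule R M, L ≠ ⊥ → N ⊓ L ≠ ⊥

/-- `M` has finite uniform dimension: no infinite independent family of nonzero submodules. -/
def HasFinUdim : Prop :=
  ¬ ∃ f : ℕ → Submodule R M, (∀ n, f n ≠ ⊥) ∧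
      ∀ n, Disjoint (f n) (⨆ (m) (_ : m ≠ n), f m)

/-- A left annihilator in `M`: an intersection `⋂_{f ∈ X} ker f` with `X ⊆ End_R(M)`. -/
def IsLeftAnnihilatorSub (N : Submodule R M) : Prop :=
  ∃ X : Set (M →ₗ[R] M), N = ⨅ f ∈ X, LinearMap.ker f

/-- ACC on left annihilators. -/
def AccLeftAnnihilators : Prop :=
  ∀ a : ℕ → Submodule R M, (∀ n, IsLeftAnnihilatorSub R M (a n)) → Monotone a →
    ∃ n, ∀ m, n ≤ m → a m = a n

/-- `M` is a Goldie module: ACC on left annihilators and finite uniform dimension. -/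
def IsGoldieModule : Prop := AccLeftAnnihilators R M ∧ HasFinUdim R M

/-- `Ann_M(K) = ⋂ { ker f | f ∈ Hom_R(M, K) }`. -/
def annM (K : Submodule R M) : Submodule R M :=
  ⨅ (f : M →ₗ[R] M) (_ : LinearMap.range f ≤ K), LinearMap.ker f

/-- `N` is an annihilator submodule: `N = Ann_M(K)` for some nonzero submodule `K`. -/
def IsAnnihilatorSub (N : Submodule R M) : Prop :=
  ∃ K : Submodule R M, K ≠ ⊥ ∧ N = annM R M K

/-- A submodule `U` is uniform: nonzero and every nonzero submodule of `U` is essential in `U`. -/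
def IsUniformSub (U : Submodule R M) : Prop :=
  U ≠ ⊥ ∧ ∀ A B : Submodule R M, A ≤ U → B ≤ U → A ≠ ⊥ → B ≠ ⊥ → A ⊓ B ≠ ⊥

/-- A submodule `U` is monoform: nonzero and every nonzero homomorphism `L → U` from a
submodule `L ≤ U` is injective. -/
def IsMonoformSub (U : Submodule R M) : Prop :=
  U ≠ ⊥ ∧ ∀ L : Submodule R M, L ≤ U → ∀ f : L →ₗ[R] U, f ≠ 0 → Function.Injective f

/-- `M` has enough monoforms: every nonzero submodule contains a monoform submodule. -/
def HasEnoughMonoforms : Prop :=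
  ∀ N : Submodule R M, N ≠ ⊥ → ∃ U : Submodule R M, U ≤ N ∧ IsMonoformSub R M U

/-- `M` is weakly compressible. -/
def WeaklyCompressible : Prop :=
  ∀ N : Submodule R M, N ≠ ⊥ → ∃ f : M →ₗ[R] M, LinearMap.range f ≤ N ∧ f ∘ₗ f ≠ 0

/-- `M` is retractable: `Hom_R(M, N) ≠ 0` for every nonzero submodule `N`. -/
def Retractable : Prop :=
  ∀ N : Submodule R M, N ≠ ⊥ → ∃ f : M →ₗ[R] M, LinearMap.range f ≤ N ∧ f ≠ 0

/-- Powers of a fully invariant submodule: `J^0 = ⊥`, `J^1 = J`, `J^(m+1) = J ·_M J^m`. -/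
def fipow (J : Submodule R M) : ℕ → Submodule R M
  | 0 => ⊥
  | 1 => J
  | n + 2 => prodM R M J (fipow J (n + 1))

end Defs

section RingDefs

variable (S : Type*) [Ring S]

/-- A ring is semiprime: no nonzero two-sided ideal squares to zero. -/
def IsSemiprimeRing : Prop :=
  ∀ I : TwoSidedIdeal S, (∀ a ∈ I, ∀ b ∈ I, a * b = 0) → I = ⊥

/-- A ring is prime: `I · J = 0` forces `I = 0` or `J = 0` for two-sided ideals. -/
def IsPrimeRing : Prop :=
  ∀ I J : TwoSidedIdeal S, (∀ a ∈ I, ∀ b ∈ J, a * b = 0) → I = ⊥ ∨ J = ⊥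

/-- A right annihilator subset of `S`: `{ s | X s = 0 }` for some `X ⊆ S`. -/
def IsRightAnnihilatorSet (T : Set S) : Prop :=
  ∃ X : Set S, T = {s : S | ∀ x ∈ X, x * s = 0}

/-- ACC on right annihilators of the ring `S`. -/
def AccRightAnnihilators : Prop :=
  ∀ a : ℕ → Set S, (∀ n, IsRightAnnihilatorSet S (a n)) → (∀ n, a n ⊆ a (n + 1)) →
    ∃ n, ∀ m, n ≤ m → a m = a n

/-- `S` is a right Goldie ring: ACC on right annihilators and finite uniform dimension
as a right `S`-module. -/
def IsRightGoldieRing : Prop :=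
  AccRightAnnihilators S ∧ HasFinUdim Sᵐᵒᵖ S

end RingDefs

theorem map_le_prodM {R : Type u} [Ring R] {M : Type v} [AddCommGroup M] [Module R M]
    (K : Submodule R M) {L : Submodule R M} {f : M →ₗ[R] M} (hf : LinearMap.range f ≤ L) :
    K.map f ≤ prodM R M K L :=
  le_iSup₂ (f := fun (f : M →ₗ[R] M) (_ : LinearMap.range f ≤ L) => K.map f) f hf

theorem prodM_le_iff {R : Type u} [Ring R] {M : Type v} [AddCommGroup M] [Module R M]
    {K L Q : Submodule R M} :
    prodM R M K L ≤ Q ↔ ∀ f : M →ₗ[R] M, LinearMap.range f ≤ L → K.map f ≤ Q :=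
  iSup₂_le_iff

theorem inSigmaM_submodule_finsupp {R : Type u} [Ring R] {M : Type v} [AddCommGroup M]
    [Module R M] {ι : Type v} (A : Submodule R (ι →₀ M)) : InSigmaM R M A :=
  ⟨ι →₀ M, inferInstance, inferInstance, ⟨ι, LinearMap.id, Function.surjective_id⟩,
    A.subtype, A.injective_subtype⟩

theorem inSigmaM_submodule {R : Type u} [Ring R] {M : Type v} [AddCommGroup M]
    [Module R M] (B : Submodule R M) : InSigmaM R M B :=
  ⟨M, inferInstance, inferInstance,
    ⟨PUnit, Finsupp.lsum ℕ fun _ => LinearMap.id, fun m => ⟨Finsupp.single PUnit.unit m, by simp⟩⟩,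
    B.subtype, B.injective_subtype⟩

/-- A map from a module projective in `σ[M]` into a sum of images `g i (N i)` lifts to the direct
sum of the `N i`. -/
theorem ProjectiveInSigmaM.exists_lift_iSup_map {R : Type u} [Ring R] {M : Type v}
    [AddCommGroup M] [Module R M] (hproj : ProjectiveInSigmaM R M) {ι : Type v}
    (N : ι → Submodule R M) (g : ι → M →ₗ[R] M) {f : M →ₗ[R] M}
    (hf : LinearMap.range f ≤ ⨆ i, (N i).map (g i)) :
    ∃ h : M →ₗ[R] ι →₀ M, (∀ m i, h m i ∈ N i) ∧ Finsupp.lsum ℕ g ∘ₗ h = f := by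
  let φ : (ι →₀ M) →ₗ[R] M := Finsupp.lsum ℕ g
  let A : Submodule R (ι →₀ M) := Finsupp.submodule N
  have hle : ⨆ i, (N i).map (g i) ≤ A.map φ := by
    refine iSup_le fun i => ?_
    rintro _ ⟨x, hx, rfl⟩
    refine ⟨Finsupp.single i x, fun j => ?_, by simp [φ]⟩
    classical
    rw [Finsupp.single_apply]
    split_ifs with hij
    · exact hij ▸ hx
    · exact zero_mem _
  obtain ⟨h, hh⟩ := hproj A (A.map φ) (inSigmaM_submodule_finsupp A) (inSigmaM_submodule _)
    (φ.submoduleMap A) (φ.submoduleMap_surjective A)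
    (f.codRestrict (A.map φ) fun m => hle (hf ⟨m, rfl⟩))
  exact ⟨A.subtype ∘ₗ h, fun m => (h m).2,
    LinearMap.ext fun m => congrArg Subtype.val (LinearMap.congr_fun hh m)⟩

theorem ProjectiveInSigmaM.prodM_iSup_map_le {R : Type u} [Ring R] {M : Type v}
    [AddCommGroup M] [Module R M] (hproj : ProjectiveInSigmaM R M) {ι : Type v}
    {K Q : Submodule R M} {N : ι → Submodule R M} (g : ι → M →ₗ[R] M)
    (hQ : IsFullyInvariant R M Q) (hKN : ∀ i, prodM R M K (N i) ≤ Q) :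
    prodM R M K (⨆ i, (N i).map (g i)) ≤ Q := by
  refine prodM_le_iff.2 fun f hf => ?_
  obtain ⟨h, hN, rfl⟩ := hproj.exists_lift_iSup_map N g hf
  rintro _ ⟨k, hk, rfl⟩
  rw [LinearMap.comp_apply, Finsupp.lsum_apply]
  refine Submodule.sum_mem _ fun i _ => hQ (g i) ⟨h k i, hKN i ?_, rfl⟩
  refine map_le_prodM K (f := Finsupp.lapply i ∘ₗ h) ?_ ⟨k, hk, rfl⟩
  rintro _ ⟨m, rfl⟩
  exact hN m i

theorem ProjectiveInSigmaM.prodM_sup_le {R : Type u} [Ring R] {M : Type v}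
    [AddCommGroup M] [Module R M] (hproj : ProjectiveInSigmaM R M)
    {K L₁ L₂ Q : Submodule R M} (hQ : IsFullyInvariant R M Q)
    (h₁ : prodM R M K L₁ ≤ Q) (h₂ : prodM R M K L₂ ≤ Q) :
    prodM R M K (L₁ ⊔ L₂) ≤ Q := by
  have h := hproj.prodM_iSup_map_le (ι := ULift Bool) (K := K)
    (N := fun i => cond i.down L₁ L₂) (fun _ => LinearMap.id) hQ
    (by rintro ⟨_ | _⟩ <;> assumption)
  have hsup : ⨆ i : ULift.{v} Bool, (cond i.down L₁ L₂).map LinearMap.id = L₁ ⊔ L₂ := by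
    simp only [Submodule.map_id, iSup_ulift, iSup_bool_eq, cond_true, cond_false]
  rwa [hsup] at h

theorem isFullyInvariant_iSup_map {R : Type u} [Ring R] {M : Type v} [AddCommGroup M]
    [Module R M] (K : Submodule R M) :
    IsFullyInvariant R M (⨆ g : M →ₗ[R] M, K.map g) := by
  intro f
  rw [Submodule.map_iSup]
  refine iSup_le fun g => ?_
  rw [← Submodule.map_comp]
  exact le_iSup (fun g : M →ₗ[R] M => K.map g) (f ∘ₗ g)

theorem le_iSup_map {R : Type u} [Ring R] {M : Type v} [AddCommGroup M]
    [Module R M] (K : Submodule R M) : K ≤ ⨆ g : M →ₗ[R] M, K.map g :=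
  (Submodule.map_id K).ge.trans (le_iSup (fun g : M →ₗ[R] M => K.map g) LinearMap.id)

theorem prodM_iSup_map_le_prodM {R : Type u} [Ring R] {M : Type v} [AddCommGroup M]
    [Module R M] (K L : Submodule R M) :
    prodM R M (⨆ g : M →ₗ[R] M, K.map g) L ≤ prodM R M K L := by
  refine prodM_le_iff.2 fun f hf => ?_
  rw [Submodule.map_iSup]
  refine iSup_le fun g => ?_
  rw [← Submodule.map_comp]
  exact map_le_prodM K ((LinearMap.range_comp_le_range g f).trans hf)

/-- For `M` projective in `σ[M]` and `P` fully invariant: `P` is prime in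
`M` iff for all submodules `K, L ⊇ P` with `K·_M L ≤ P`, `K = P` or `L = P`. -/
theorem stmt16 (R : Type u) [Ring R] (M : Type v) [AddCommGroup M] [Module R M]
    (hproj : ProjectiveInSigmaM R M) (P : Submodule R M)
    (hPfi : IsFullyInvariant R M P) :
    IsPrimeSubmodule R M P ↔
      ∀ K L : Submodule R M, P ≤ K → P ≤ L → prodM R M K L ≤ P →
        K = P ∨ L = P := by
  constructor
  · rintro ⟨-, hP⟩ K L hPK hPL hKL
    refine (hP _ _ (isFullyInvariant_iSup_map K) (isFullyInvariant_iSup_map L) ?_).imp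
      (fun h => le_antisymm ((le_iSup_map K).trans h) hPK)
      (fun h => le_antisymm ((le_iSup_map L).trans h) hPL)
    exact hproj.prodM_iSup_map_le (N := fun _ => L) (fun g => g) hPfi
      fun _ => (prodM_iSup_map_le_prodM K L).trans hKL
  · refine fun H => ⟨hPfi, fun K L _ _ hKL => ?_⟩
    refine (H (K ⊔ P) (L ⊔ P) le_sup_right le_sup_right ?_).imp sup_eq_right.1 sup_eq_right.1
    refine hproj.prodM_sup_le hPfi ?_ ?_ <;> refine prodM_le_iff.2 fun f hf => ?_ <;>
      rw [Submodule.map_sup]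
    · exact sup_le ((map_le_prodM K hf).trans hKL) (hPfi f)
    · exact sup_le (LinearMap.map_le_range.trans hf) (hPfi f)
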